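/- arXiv:1501.05676 — 8 statements merged into one kernel-verified Lean document; each statement's English description precedes it below -/
import Mathlib

section
/- Let G be a group, A a subgroup of G, and k ≥ 3 an integer. Then G is a setwise product G = A₁A₂⋯A_k of k conjugates A₁,…,A_k of A if and only if there exist elements x₁,…,x_{k−1} ∈ G such that G = (Ax₁A)(Ax₂A)⋯(Ax_{k−1}A), a setwise product of k−1 double cosets of A. -/
open Pointwise

/-- The conjugate `x⁻¹ A x` of a set `A` by an element `x`. -/
def conjSet {G : Type*} [Group G] (A : Set G) (x : G) : Set G :=
  (fun a => x⁻¹ * a * x) '' A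

/-- The double coset `A x A` of a set `A` and an element `x`. -/
def dcoset {G : Type*} [Group G] (A : Set G) (x : G) : Set G :=
  A * {x} * A

theorem conjSet_eq_mul {G : Type*} [Group G] (A : Set G) (x : G) :
    conjSet A x = {x⁻¹} * A * {x} := by
  rw [conjSet, Set.singleton_mul, Set.mul_singleton, Set.image_image]

theorem coe_mul_prod_dcoset {G : Type*} [Group G] (A : Subgroup G) (n : ℕ)
    (x : Fin (n + 1) → G) :
    (A : Set G) * (List.ofFn (fun i => dcoset (A : Set G) (x i))).prod =
      (List.ofFn (fun i => dcoset (A : Set G) (x i))).prod := by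
  rw [List.ofFn_succ, List.prod_cons]
  simp only [dcoset, ← mul_assoc, coe_mul_coe]

theorem prod_conjSet_eq {G : Type*} [Group G] (A : Subgroup G) (n : ℕ)
    (g : Fin (n + 2) → G) :
    (List.ofFn (fun i => conjSet (A : Set G) (g i))).prod =
      {(g 0)⁻¹} * (List.ofFn (fun i : Fin (n + 1) =>
        dcoset (A : Set G) (g i.castSucc * (g i.succ)⁻¹))).prod * {g (Fin.last (n + 1))} := by
  induction n with
  | zero =>
    simp only [List.ofFn_succ, List.ofFn_zero, List.prod_cons, List.prod_nil, mul_one,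
      conjSet_eq_mul, dcoset, ← Set.singleton_mul_singleton, mul_assoc]
    rfl
  | succ n ih =>
    rw [List.ofFn_succ, List.prod_cons, ih (fun i => g i.succ)]
    rw [List.ofFn_succ (n := n + 1), List.prod_cons]
    have h := coe_mul_prod_dcoset A n
      (fun i => g i.succ.castSucc * (g i.succ.succ)⁻¹)
    simp only [Fin.succ_castSucc, Fin.succ_last, Fin.castSucc_zero] at h ⊢
    rw [conjSet_eq_mul, dcoset, ← Set.singleton_mul_singleton]
    simp only [mul_assoc]
    rw [← mul_assoc (A : Set G) (List.prod _), h]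

theorem singleton_mul_univ_mul_singleton {G : Type*} [Group G] (a b : G) :
    ({a} : Set G) * Set.univ * {b} = Set.univ := by
  refine Set.eq_univ_of_forall fun y => ?_
  exact Set.mem_mul.2 ⟨y * b⁻¹, Set.mem_mul.2 ⟨a, rfl, a⁻¹ * (y * b⁻¹), trivial, by simp⟩,
    b, rfl, by simp⟩

theorem singleton_conj_eq_univ {G : Type*} [Group G] (a b : G) (P : Set G) :
    {a} * P * {b} = Set.univ ↔ P = Set.univ := by
  constructor
  · intro h
    have h2 : ({a⁻¹} : Set G) * ({a} * P * {b}) * {b⁻¹} = P := by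
      simp only [← mul_assoc, Set.singleton_mul_singleton, inv_mul_cancel]
      simp only [mul_assoc, Set.singleton_mul_singleton, mul_inv_cancel]
      simp
    rw [← h2, h]
    exact singleton_mul_univ_mul_singleton _ _
  · rintro rfl
    exact singleton_mul_univ_mul_singleton _ _

/-- For `k ≥ 3`, `G` is the setwise product of `k` conjugates of the
subgroup `A` if and only if `G` is the setwise product of `k - 1` double cosets of `A`. -/
theorem prod_conjugates_iff_prod_double_cosets {G : Type*} [Group G] (A : Subgroup G)
    (k : ℕ) (hk : 3 ≤ k) :
    (∃ g : Fin k → G,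
        (List.ofFn (fun i => conjSet (A : Set G) (g i))).prod = Set.univ) ↔
      (∃ x : Fin (k - 1) → G,
        (List.ofFn (fun i => dcoset (A : Set G) (x i))).prod = Set.univ) := by
  obtain ⟨n, rfl⟩ : ∃ n, k = n + 2 := ⟨k - 2, by omega⟩
  constructor
  · rintro ⟨g, hg⟩
    rw [prod_conjSet_eq, singleton_conj_eq_univ] at hg
    exact ⟨_, hg⟩
  · rintro ⟨x, hx⟩
    change Fin (n + 1) → G at x
    refine ⟨fun i => (Fin.partialProd x i)⁻¹, ?_⟩
    rw [prod_conjSet_eq, singleton_conj_eq_univ]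
    simp only [inv_inv, Fin.partialProd_right_inv]
    exact hx
end

section
/- Let G be a group, A a subgroup of G, and x, y ∈ G. If G = A·A^x·A^y (setwise product), then y ∈ A·A^x. -/
open Pointwise

/-- If `G = A·Aˣ·Aʸ` (setwise product), then `y ∈ A·Aˣ`. -/
theorem prod_three_conj_eq_univ_imp_mem {G : Type*} [Group G] (A : Subgroup G) (x y : G)
    (h : (A : Set G) * conjSet (A : Set G) x * conjSet (A : Set G) y = Set.univ) :
    y ∈ (A : Set G) * conjSet (A : Set G) x := by
  have hy : y ∈ (A : Set G) * conjSet (A : Set G) x * conjSet (A : Set G) y := by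
    rw [h]; exact Set.mem_univ y
  obtain ⟨_, ⟨a, ha, _, ⟨b, hb, rfl⟩, rfl⟩, _, ⟨c, hc, rfl⟩, e⟩ := hy
  refine ⟨c * a, A.mul_mem hc ha, x⁻¹ * b * x, ⟨b, hb, rfl⟩, ?_⟩
  have e1 : a * (x⁻¹ * b * x) * y⁻¹ * c = 1 := by
    apply mul_right_cancel (b := y)
    rw [one_mul]
    simpa [mul_assoc] using e
  have e2 : a * (x⁻¹ * b * x) = c⁻¹ * y := by
    rw [mul_eq_one_iff_eq_inv, mul_inv_eq_iff_eq_mul] at e1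
    exact e1
  change c * a * (x⁻¹ * b * x) = y
  rw [mul_assoc c a, e2, mul_inv_cancel_left]
end

section
/- Let G be a group, A a subgroup of G, and x ∈ G. Let Ω_A = {Ag : g ∈ G} be the set of right cosets of A in G, on which A acts by right multiplication, and let O be the A-orbit of the coset Ax⁻¹ under this action. Then G = A·A^x·A if and only if the set Ox := {Cx : C ∈ O} of right cosets intersects every A-orbit of the action of A on Ω_A. Furthermore, Ox intersects every A-orbit on Ω_A if and only if Oz := {Cz : C ∈ O} intersects every A-orbit on Ω_A, where z is an arbitrary element of the double coset AxA. -/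
open Pointwise

/-- The orbit of the right coset `A g` under the right multiplication action of `A`
on the set of right cosets of `A`, viewed as a family of subsets of `G`:
it consists of the cosets `A (g a)` for `a ∈ A`. -/
def cosetOrbit {G : Type*} [Group G] (A : Subgroup G) (g : G) : Set (Set G) :=
  {C | ∃ a ∈ A, C = (A : Set G) * ({g * a} : Set G)}

theorem coset_eq_iff_aux {G : Type*} [Group G] (A : Subgroup G) (u v : G) :
    (A : Set G) * ({u} : Set G) = (A : Set G) * ({v} : Set G) ↔ ∃ c ∈ A, v = c * u := by
  constructor
  · intro h
    have hv : v ∈ (A : Set G) * ({v} : Set G) := ⟨1, A.one_mem, v, rfl, one_mul v⟩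
    rw [← h] at hv
    obtain ⟨c, hc, w, hw, e⟩ := hv
    obtain rfl : w = u := hw
    exact ⟨c, hc, e.symm⟩
  · rintro ⟨c, hc, rfl⟩
    ext y
    constructor
    · rintro ⟨a, ha, w, hw, rfl⟩
      obtain rfl : w = u := hw
      exact ⟨a * c⁻¹, A.mul_mem ha (A.inv_mem hc), c * w, rfl, by simp [mul_assoc]⟩
    · rintro ⟨a, ha, w, hw, rfl⟩
      obtain rfl : w = c * u := hw
      exact ⟨a * c, A.mul_mem ha hc, u, rfl, by simp [mul_assoc]⟩

theorem orbit_meets_iff_aux {G : Type*} [Group G] (A : Subgroup G) (x z g : G) :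
    (∃ C ∈ (fun C => C * ({z} : Set G)) '' cosetOrbit A x⁻¹, C ∈ cosetOrbit A g) ↔
      ∃ c ∈ A, ∃ a ∈ A, ∃ b ∈ A, g = c * (x⁻¹ * a * z) * b := by
  constructor
  · rintro ⟨_, ⟨_, ⟨a, ha, rfl⟩, rfl⟩, b, hb, e⟩
    simp only [mul_assoc (A : Set G), Set.singleton_mul_singleton] at e
    obtain ⟨c, hc, e⟩ := (coset_eq_iff_aux A _ _).1 e
    exact ⟨c, hc, a, ha, b⁻¹, A.inv_mem hb, by rw [← e]; group⟩
  · rintro ⟨c, hc, a, ha, b, hb, rfl⟩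
    refine ⟨_, ⟨_, ⟨a, ha, rfl⟩, rfl⟩, b⁻¹, A.inv_mem hb, ?_⟩
    simp only [mul_assoc (A : Set G), Set.singleton_mul_singleton]
    exact (coset_eq_iff_aux A _ _).2 ⟨c, hc, by group⟩

/-- `G = A·Aˣ·A` if and only if `O x` intersects every orbit of the
right multiplication action of `A` on the right cosets of `A`, where `O` is the
`A`-orbit of the coset `A x⁻¹`. Furthermore, `O x` intersects every orbit if and only
if `O z` does, for an arbitrary element `z` of the double coset `A x A`. -/
theorem prod_AAxA_iff_orbit_intersects {G : Type*} [Group G] (A : Subgroup G) (x : G) :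
    ((A : Set G) * conjSet (A : Set G) x * (A : Set G) = Set.univ ↔
      ∀ g : G, ∃ C ∈ (fun C => C * ({x} : Set G)) '' cosetOrbit A x⁻¹,
        C ∈ cosetOrbit A g) ∧
    (∀ z ∈ dcoset (A : Set G) x,
      ((∀ g : G, ∃ C ∈ (fun C => C * ({x} : Set G)) '' cosetOrbit A x⁻¹,
          C ∈ cosetOrbit A g) ↔
       (∀ g : G, ∃ C ∈ (fun C => C * ({z} : Set G)) '' cosetOrbit A x⁻¹,
          C ∈ cosetOrbit A g))) := by
  simp only [orbit_meets_iff_aux]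
  refine ⟨?_, ?_⟩
  · rw [Set.eq_univ_iff_forall]
    refine forall_congr' fun g => ?_
    constructor
    · rintro ⟨_, ⟨c, hc, _, ⟨a, ha, rfl⟩, rfl⟩, b, hb, rfl⟩
      exact ⟨c, hc, a, ha, b, hb, rfl⟩
    · rintro ⟨c, hc, a, ha, b, hb, rfl⟩
      exact ⟨_, ⟨c, hc, _, ⟨a, ha, rfl⟩, rfl⟩, b, hb, rfl⟩
  · rintro z ⟨_, ⟨p, hp, w, hw, rfl⟩, q, hq, rfl⟩
    obtain rfl : w = x := hw
    refine forall_congr' fun g => ?_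
    constructor
    · rintro ⟨c, hc, a, ha, b, hb, rfl⟩
      exact ⟨c, hc, a * p⁻¹, A.mul_mem ha (A.inv_mem hp), q⁻¹ * b,
        A.mul_mem (A.inv_mem hq) hb, by simp [mul_assoc]⟩
    · rintro ⟨c, hc, a, ha, b, hb, rfl⟩
      exact ⟨c, hc, a * p, A.mul_mem ha hp, q * b, A.mul_mem hq hb, by simp [mul_assoc]⟩
end

section
/- Let G be a group and A a subgroup of G. If there exist g, h ∈ G such that G = A^g·A^h (setwise product of two conjugates of A), then A = G. Consequently, no group is the setwise product of two conjugates of a proper subgroup, i.e., for any non-trivial group the minimal number of conjugates of a proper subgroup whose setwise product is the whole group is at least 3. -/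
open Pointwise

/-- If `G` is the setwise product of two conjugates of a subgroup `A`,
then `A = G`; consequently no group is the setwise product of two conjugates of a
proper subgroup. -/
theorem eq_top_of_prod_two_conj {G : Type*} [Group G] (A : Subgroup G)
    (h : ∃ g h : G, conjSet (A : Set G) g * conjSet (A : Set G) h = Set.univ) :
    A = ⊤ := by
  obtain ⟨g, h, hu⟩ := h
  have key : ∀ x : G, ∃ a ∈ A, ∃ b ∈ A, x = a * (g * h⁻¹) * b := by
    intro x
    have hx : g⁻¹ * x * h ∈ conjSet (A : Set G) g * conjSet (A : Set G) h := by
      rw [hu]; exact Set.mem_univ _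
    obtain ⟨_, ⟨a, ha, rfl⟩, _, ⟨b, hb, rfl⟩, e⟩ := hx
    refine ⟨a, ha, b, hb, ?_⟩
    have e' : g⁻¹ * a * g * (h⁻¹ * b * h) = g⁻¹ * x * h := e
    calc x = g * (g⁻¹ * x * h) * h⁻¹ := by group
      _ = a * (g * h⁻¹) * b := by rw [← e']; group
  have hgh : g * h⁻¹ ∈ A := by
    obtain ⟨a, ha, b, hb, e⟩ := key 1
    have e2 : g * h⁻¹ = a⁻¹ * 1 * b⁻¹ := by rw [e]; group
    rw [e2, mul_one]
    exact A.mul_mem (A.inv_mem ha) (A.inv_mem hb)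
  rw [eq_top_iff]
  intro x _
  obtain ⟨a, ha, b, hb, e⟩ := key x
  rw [e]
  exact A.mul_mem (A.mul_mem ha hgh) hb
end

section
/- Let G be a group with a BN-pair whose Weyl group W is infinite. Then G is not equal to any finite setwise product of double cosets of B, i.e., for every m ≥ 1 and all g₁, …, g_m ∈ G one has (Bg₁B)(Bg₂B)⋯(Bg_mB) ≠ G. -/
open Pointwise

/-- `S` is contained in a finite union of double cosets `B n B` with `n ∈ N`. -/
def BNFin {G : Type*} [Group G] (B N : Subgroup G) (S : Set G) : Prop :=
  ∃ F : Set N, F.Finite ∧ ∀ x ∈ S, ∃ n ∈ F, ∃ b ∈ B, ∃ b' ∈ B, x = b * (n : G) * b'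

/-- Multiplication by `B g B` preserves `BNFin`. -/
def BNGood {G : Type*} [Group G] (B N : Subgroup G) (g : G) : Prop :=
  ∀ S : Set G, BNFin B N S → BNFin B N (((B : Set G) * {g} * (B : Set G)) * S)

theorem BNFin.mono {G : Type*} [Group G] {B N : Subgroup G} {S T : Set G}
    (h : BNFin B N T) (hST : S ⊆ T) : BNFin B N S := by
  obtain ⟨F, hF, h⟩ := h
  exact ⟨F, hF, fun x hx => h x (hST hx)⟩

theorem mem_dc {G : Type*} [Group G] {B : Subgroup G} {g x : G} :
    x ∈ (B : Set G) * {g} * (B : Set G) ↔ ∃ b ∈ B, ∃ b' ∈ B, x = b * g * b' := by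
  constructor
  · rintro ⟨_, ⟨b, hb, _, rfl, rfl⟩, b', hb', rfl⟩
    exact ⟨b, hb, b', hb', rfl⟩
  · rintro ⟨b, hb, b', hb', rfl⟩
    exact ⟨_, ⟨b, hb, _, rfl, rfl⟩, b', hb', rfl⟩

theorem BNGood.mul {G : Type*} [Group G] {B N : Subgroup G} {g h : G}
    (hg : BNGood B N g) (hh : BNGood B N h) : BNGood B N (g * h) := by
  intro S hS
  refine (hg _ (hh S hS)).mono ?_
  rintro _ ⟨x, hx, y, hy, rfl⟩
  obtain ⟨b, hb, b', hb', rfl⟩ := mem_dc.1 hx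
  refine ⟨b * g * 1, mem_dc.2 ⟨b, hb, 1, B.one_mem, rfl⟩, 1 * h * b' * y,
    ⟨_, mem_dc.2 ⟨1, B.one_mem, b', hb', rfl⟩, y, hy, rfl⟩, ?_⟩
  simp only
  group

theorem BNGood.of_mem {G : Type*} [Group G] {B N : Subgroup G} {g : G}
    (hg : g ∈ B) : BNGood B N g := by
  rintro S ⟨F, hF, h⟩
  refine ⟨F, hF, ?_⟩
  rintro _ ⟨x, hx, y, hy, rfl⟩
  obtain ⟨b, hb, b', hb', rfl⟩ := mem_dc.1 hx
  obtain ⟨n, hn, c, hc, c', hc', rfl⟩ := h y hy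
  refine ⟨n, hn, b * g * b' * c, ?_, c', hc', ?_⟩
  · exact B.mul_mem (B.mul_mem (B.mul_mem hb hg) hb') hc
  · simp only
    group

/-- The subgroup of elements which are good along with their inverses. -/
def BNGoodSubgroup {G : Type*} [Group G] (B N : Subgroup G) : Subgroup G where
  carrier := {g | BNGood B N g ∧ BNGood B N g⁻¹}
  one_mem' := ⟨BNGood.of_mem B.one_mem, BNGood.of_mem (B.inv_mem B.one_mem)⟩
  mul_mem' := by
    rintro a b ⟨ha, ha'⟩ ⟨hb, hb'⟩
    refine ⟨ha.mul hb, ?_⟩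
    rw [mul_inv_rev]
    exact hb'.mul ha'
  inv_mem' := by
    rintro a ⟨ha, ha'⟩
    refine ⟨ha', ?_⟩
    rw [inv_inv]
    exact ha

theorem BN_distinct {G : Type*} [Group G] (B N : Subgroup G)
    [hH : (B.subgroupOf N).Normal]
    {I : Type*} (s : I → N ⧸ B.subgroupOf N)
    (axSq : ∀ i, s i * s i = 1)
    (hP : ∀ (i : I) (ni n : N), QuotientGroup.mk ni = s i → ∀ b ∈ B,
      ∃ c ∈ B, ∃ c' ∈ B, (ni : G) * b * n = c * ((ni * n : N) : G) * c' ∨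
        (ni : G) * b * n = c * (n : G) * c') :
    ∀ (l : List I) (n n' : N), (QuotientGroup.mk n : N ⧸ B.subgroupOf N) = (l.map s).prod →
      (∀ l' : List I, l'.length < l.length →
        (l'.map s).prod ≠ (QuotientGroup.mk n' : N ⧸ B.subgroupOf N)) →
      (∃ b ∈ B, ∃ b' ∈ B, (n' : G) = b * n * b') →
      (QuotientGroup.mk n : N ⧸ B.subgroupOf N) = QuotientGroup.mk n' := by
  intro l
  induction l with
  | nil =>
    rintro n n' hn - ⟨b, hb, b', hb', h⟩
    have hn1 : (QuotientGroup.mk n : N ⧸ B.subgroupOf N) = 1 := by simpa using hn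
    have hnB : (n : G) ∈ B := by
      rw [QuotientGroup.eq_one_iff] at hn1
      exact Subgroup.mem_subgroupOf.1 hn1
    have hn'B : (n' : G) ∈ B := by
      rw [h]
      exact B.mul_mem (B.mul_mem hb hnB) hb'
    rw [hn1, eq_comm, QuotientGroup.eq_one_iff]
    exact Subgroup.mem_subgroupOf.2 hn'B
  | cons i l ih =>
    rintro n n' hn hlen ⟨b, hb, b', hb', h⟩
    obtain ⟨t, ht⟩ := QuotientGroup.mk_surjective (s i)
    have hsi : (s i)⁻¹ = s i := inv_eq_of_mul_eq_one_left (axSq i)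
    have ht' : (QuotientGroup.mk t⁻¹ : N ⧸ B.subgroupOf N) = s i := by
      rw [QuotientGroup.mk_inv, ht, hsi]
    have hv : (QuotientGroup.mk (t⁻¹ * n) : N ⧸ B.subgroupOf N) = (l.map s).prod := by
      rw [QuotientGroup.mk_mul, ht', hn, List.map_cons, List.prod_cons, ← mul_assoc, axSq,
        one_mul]
    obtain ⟨c, hc, c', hc', hcc⟩ := hP i t⁻¹ n' ht' b⁻¹ (B.inv_mem hb)
    have hnn : (n : G) = b⁻¹ * n' * b'⁻¹ := by
      rw [h]
      group
    rcases hcc with hcc | hcc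
    · have key := ih (t⁻¹ * n) (t⁻¹ * n') hv ?_ ?_
      · rw [QuotientGroup.mk_mul, QuotientGroup.mk_mul] at key
        exact mul_left_cancel key
      · intro l' hl' he
        refine hlen (i :: l') (by simpa using hl') ?_
        rw [List.map_cons, List.prod_cons, he, QuotientGroup.mk_mul, ht', ← mul_assoc, axSq,
          one_mul]
      · refine ⟨c⁻¹, B.inv_mem hc, b' * c'⁻¹, B.mul_mem hb' (B.inv_mem hc'), ?_⟩
        have e : ((t⁻¹ * n' : N) : G) = c⁻¹ * (((t⁻¹ : N) : G) * b⁻¹ * n') * c'⁻¹ := by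
          rw [hcc]
          group
        rw [e, Subgroup.coe_mul, hnn]
        group
    · exfalso
      have key := ih (t⁻¹ * n) n' hv ?_ ?_
      · exact hlen l (by simp) (hv.symm.trans key)
      · intro l' hl'
        exact hlen l' (by simp only [List.length_cons]; omega)
      · refine ⟨c⁻¹, B.inv_mem hc, b' * c'⁻¹, B.mul_mem hb' (B.inv_mem hc'), ?_⟩
        have e : (n' : G) = c⁻¹ * (((t⁻¹ : N) : G) * b⁻¹ * n') * c'⁻¹ := by
          rw [hcc]
          group
        rw [Subgroup.coe_mul, hnn]
        refine e.trans ?_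
        group

/-- Let `G` be a group with a `BN`-pair whose Weyl group
`W = N / (B ∩ N)` is infinite. Then `G` is not a finite setwise product of double
cosets of `B`: for any nonempty list `g₁, …, gₘ` of elements of `G`,
`(Bg₁B)⋯(BgₘB) ≠ G`. -/
theorem BN_pair_infinite_Weyl_no_dcoset_product {G : Type*} [Group G] (B N : Subgroup G)
    [hH : (B.subgroupOf N).Normal]
    {I : Type*} (s : I → N ⧸ B.subgroupOf N)
    -- (i) G is generated by B ∪ N
    (axBN : Subgroup.closure ((B : Set G) ∪ (N : Set G)) = ⊤)
    -- (iii) the Weyl group is generated by the involutions `s i`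
    (axGen : Subgroup.closure (Set.range s) = ⊤)
    (axSq : ∀ i, s i * s i = 1)
    -- (iv) `nᵢ B nᵢ ≠ B` for every preimage `nᵢ` of `s i`
    (axNotB : ∀ (i : I) (ni : N), QuotientGroup.mk ni = s i →
      ({(ni : G)} : Set G) * (B : Set G) * {(ni : G)} ≠ (B : Set G))
    -- (v) `nᵢ B n ⊆ B nᵢ n B ∪ B n B`
    (axProd : ∀ (i : I) (ni n : N), QuotientGroup.mk ni = s i →
      ({(ni : G)} : Set G) * (B : Set G) * {(n : G)} ⊆
        (B : Set G) * {((ni * n : N) : G)} * (B : Set G) ∪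
          (B : Set G) * {(n : G)} * (B : Set G))
    -- the Weyl group is infinite
    (hinf : Infinite (N ⧸ B.subgroupOf N)) :
    ∀ l : List G, l ≠ [] →
      (l.map fun g => (B : Set G) * {g} * (B : Set G)).prod ≠ Set.univ := by
  classical
  have hP : ∀ (i : I) (ni n : N), QuotientGroup.mk ni = s i → ∀ b ∈ B,
      ∃ c ∈ B, ∃ c' ∈ B, (ni : G) * b * n = c * ((ni * n : N) : G) * c' ∨
        (ni : G) * b * n = c * (n : G) * c' := by
    intro i ni n hi b hb
    have hm : (ni : G) * b * n ∈ ({(ni : G)} : Set G) * (B : Set G) * {(n : G)} :=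
      ⟨_, ⟨_, rfl, b, hb, rfl⟩, _, rfl, rfl⟩
    rcases axProd i ni n hi hm with h | h
    · obtain ⟨c, hc, c', hc', h⟩ := mem_dc.1 h
      exact ⟨c, hc, c', hc', Or.inl h⟩
    · obtain ⟨c, hc, c', hc', h⟩ := mem_dc.1 h
      exact ⟨c, hc, c', hc', Or.inr h⟩
  have hsi : ∀ i, (s i)⁻¹ = s i := fun i => inv_eq_of_mul_eq_one_left (axSq i)
  -- generators are good
  have hgen : ∀ (i : I) (t : N), QuotientGroup.mk t = s i → BNGood B N (t : G) := by
    rintro i t ht S ⟨F, hF, h⟩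
    refine ⟨F ∪ (fun n => t * n) '' F, hF.union (hF.image _), ?_⟩
    rintro _ ⟨x, hx, y, hy, rfl⟩
    obtain ⟨b, hb, b', hb', rfl⟩ := mem_dc.1 hx
    obtain ⟨n, hn, c, hc, c', hc', rfl⟩ := h y hy
    obtain ⟨d, hd, d', hd', hdd⟩ := hP i t n ht (b' * c) (B.mul_mem hb' hc)
    have e : b * (t : G) * b' * (c * (n : G) * c') = b * ((t : G) * (b' * c) * n) * c' := by
      group
    rcases hdd with hdd | hdd
    · refine ⟨t * n, Or.inr ⟨n, hn, rfl⟩, b * d, B.mul_mem hb hd, d' * c',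
        B.mul_mem hd' hc', ?_⟩
      simp only
      rw [e, hdd]
      group
    · refine ⟨n, Or.inl hn, b * d, B.mul_mem hb hd, d' * c', B.mul_mem hd' hc', ?_⟩
      simp only
      rw [e, hdd]
      group
  have hBT : B ≤ BNGoodSubgroup B N := fun b hb =>
    ⟨BNGood.of_mem hb, BNGood.of_mem (B.inv_mem hb)⟩
  have hNT' : ∀ w : N ⧸ B.subgroupOf N, w ∈ Subgroup.closure (Set.range s) →
      ∀ n : N, QuotientGroup.mk n = w → (n : G) ∈ BNGoodSubgroup B N := by
    intro w hw
    induction hw using Subgroup.closure_induction with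
    | mem x hx =>
      obtain ⟨i, rfl⟩ := hx
      intro n hn
      refine ⟨hgen i n hn, ?_⟩
      have := hgen i n⁻¹ (by rw [QuotientGroup.mk_inv, hn, hsi])
      simpa using this
    | one =>
      intro n hn
      rw [QuotientGroup.eq_one_iff] at hn
      exact hBT (Subgroup.mem_subgroupOf.1 hn)
    | mul x y _ _ ihx ihy =>
      intro n hn
      obtain ⟨a, ha⟩ := QuotientGroup.mk_surjective x
      have h1 := ihx a ha
      have h2 := ihy (a⁻¹ * n) (by rw [QuotientGroup.mk_mul, QuotientGroup.mk_inv, ha, hn]; group)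
      have h3 := (BNGoodSubgroup B N).mul_mem h1 h2
      simpa using h3
    | inv x _ ihx =>
      intro n hn
      have h1 := ihx n⁻¹ (by rw [QuotientGroup.mk_inv, hn, inv_inv])
      simpa using h1
  have hT : ∀ g : G, BNGood B N g := by
    have hle : Subgroup.closure ((B : Set G) ∪ (N : Set G)) ≤ BNGoodSubgroup B N := by
      rw [Subgroup.closure_le]
      rintro x (hx | hx)
      · exact hBT hx
      · exact hNT' _ (by rw [axGen]; trivial) ⟨x, hx⟩ rfl
    intro g
    have : g ∈ BNGoodSubgroup B N := hle (by rw [axBN]; trivial)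
    exact this.1
  have hlist : ∀ l : List G,
      BNFin B N (l.map fun g => (B : Set G) * {g} * (B : Set G)).prod := by
    intro l
    induction l with
    | nil =>
      refine ⟨{1}, Set.finite_singleton _, ?_⟩
      intro x hx
      refine ⟨1, rfl, 1, B.one_mem, 1, B.one_mem, ?_⟩
      simpa using hx
    | cons g l ih =>
      rw [List.map_cons, List.prod_cons]
      exact hT g _ ih
  -- every element of the Weyl group is a word
  have hword : ∀ w : N ⧸ B.subgroupOf N, ∃ l : List I, (l.map s).prod = w := by
    intro w
    have hw : w ∈ Subgroup.closure (Set.range s) := by rw [axGen]; trivial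
    induction hw using Subgroup.closure_induction with
    | mem x hx =>
      obtain ⟨i, rfl⟩ := hx
      exact ⟨[i], by simp⟩
    | one => exact ⟨[], rfl⟩
    | mul x y _ _ ihx ihy =>
      obtain ⟨l, rfl⟩ := ihx
      obtain ⟨m, rfl⟩ := ihy
      exact ⟨l ++ m, by simp⟩
    | inv x _ ihx =>
      obtain ⟨l, rfl⟩ := ihx
      refine ⟨l.reverse, ?_⟩
      rw [List.prod_inv_reverse, List.map_map, List.map_reverse]
      congr 2
      exact List.map_congr_left fun i _ => (hsi i).symm
  have hmin : ∀ w : N ⧸ B.subgroupOf N, ∃ l : List I, (l.map s).prod = w ∧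
      ∀ l' : List I, (l'.map s).prod = w → l.length ≤ l'.length := by
    intro w
    have hex : ∃ k, ∃ l : List I, (l.map s).prod = w ∧ l.length = k := by
      obtain ⟨l, hl⟩ := hword w
      exact ⟨_, l, hl, rfl⟩
    obtain ⟨l, hl, hk⟩ := Nat.find_spec hex
    refine ⟨l, hl, fun l' hl' => ?_⟩
    rw [hk]
    exact Nat.find_min' hex ⟨l', hl', rfl⟩
  have hdist : ∀ n n' : N, (∃ b ∈ B, ∃ b' ∈ B, (n' : G) = b * n * b') →
      (QuotientGroup.mk n : N ⧸ B.subgroupOf N) = QuotientGroup.mk n' := by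
    intro n n' h
    obtain ⟨l, hl, hlm⟩ := hmin (QuotientGroup.mk n)
    obtain ⟨m, hm, hmm⟩ := hmin (QuotientGroup.mk n')
    rcases le_total l.length m.length with hle | hle
    · refine BN_distinct B N s axSq hP l n n' hl.symm ?_ h
      intro l' hl' he
      have := hmm l' he
      omega
    · refine (BN_distinct B N s axSq hP m n' n hm.symm ?_ ?_).symm
      · intro l' hl' he
        have := hlm l' he
        omega
      · obtain ⟨b, hb, b', hb', h⟩ := h
        refine ⟨b⁻¹, B.inv_mem hb, b'⁻¹, B.inv_mem hb', ?_⟩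
        rw [h]
        group
  intro l _ hl
  obtain ⟨F, hF, h⟩ := hlist l
  rw [hl] at h
  have hfin : (Set.univ : Set (N ⧸ B.subgroupOf N)).Finite := by
    refine (hF.image (fun n => (QuotientGroup.mk n : N ⧸ B.subgroupOf N))).subset ?_
    intro w _
    obtain ⟨n', rfl⟩ := QuotientGroup.mk_surjective w
    obtain ⟨n, hn, hb⟩ := h (n' : G) trivial
    exact ⟨n, hn, hdist n n' hb⟩
  exact Set.infinite_univ hfin
end

section
/- Let G be a group with a BN-pair whose Weyl group W is finite, let n₀ ∈ N be any element with n₀H = w₀, and let U be a subgroup of B such that B = UH. Then G = H·U·U^{n₀}·U. -/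
open Pointwise

/-- The length of `w` with respect to a generating set `S`: the least number of
factors in an expression of `w` as a product of elements of `S` (`0` for `w = 1`). -/
noncomputable def wordLength {W : Type*} [Monoid W] (S : Set W) (w : W) : ℕ :=
  sInf {k | ∃ l : List W, (∀ x ∈ l, x ∈ S) ∧ l.length = k ∧ l.prod = w}

theorem wl_le {W : Type*} [Group W] (S : Set W) (l : List W) (h : ∀ x ∈ l, x ∈ S) :
    wordLength S l.prod ≤ l.length := Nat.sInf_le ⟨l, h, rfl, rfl⟩

theorem wl_exists {W : Type*} [Group W] (S : Set W) (hS : ∀ x ∈ S, x * x = 1)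
    (hgen : Subgroup.closure S = ⊤) (w : W) :
    ∃ l : List W, (∀ x ∈ l, x ∈ S) ∧ l.length = wordLength S w ∧ l.prod = w := by
  have hne : {k | ∃ l : List W, (∀ x ∈ l, x ∈ S) ∧ l.length = k ∧ l.prod = w}.Nonempty := by
    have hw : w ∈ Subgroup.closure S := by rw [hgen]; trivial
    rw [← Subgroup.mem_toSubmonoid, Subgroup.closure_toSubmonoid] at hw
    obtain ⟨l, hl, hp⟩ := Submonoid.exists_list_of_mem_closure hw
    refine ⟨_, l, ?_, rfl, hp⟩
    intro x hx
    rcases hl x hx with h | h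
    · exact h
    · have : x⁻¹ = x := by
        have h2 := hS _ h
        have h3 := inv_eq_of_mul_eq_one_left h2
        rw [inv_inv] at h3
        exact h3.symm
      rwa [Set.mem_inv, this] at h
  exact Nat.sInf_mem hne

section abs
variable {W : Type*} [Group W] {S : Set W} (hS : ∀ x ∈ S, x * x = 1)
  (hgen : Subgroup.closure S = ⊤)

theorem wl_one : wordLength S (1 : W) = 0 := by
  have := wl_le S [] (by simp)
  simpa using this

theorem wl_mul (hS : ∀ x ∈ S, x * x = 1)
  (hgen : Subgroup.closure S = ⊤) {t : W} (ht : t ∈ S) (w : W) :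
    wordLength S (t * w) ≤ wordLength S w + 1 := by
  obtain ⟨l, h1, h2, h3⟩ := wl_exists S hS hgen w
  have := wl_le S (t :: l) (by simpa [ht] using h1)
  simpa [h2, h3] using this

theorem wl_inv_le (hS : ∀ x ∈ S, x * x = 1)
  (hgen : Subgroup.closure S = ⊤) (w : W) :
    wordLength S w⁻¹ ≤ wordLength S w := by
  obtain ⟨l, h1, h2, h3⟩ := wl_exists S hS hgen w
  have hl : l.map (fun x => x⁻¹) = l := by
    conv_rhs => rw [← List.map_id l]
    apply List.map_congr_left
    intro x hx
    exact inv_eq_of_mul_eq_one_left (hS x (h1 x hx))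
  have h4 : w⁻¹ = l.reverse.prod := by
    rw [← h3, List.prod_inv_reverse]
    rw [hl]
  rw [h4, ← h2]
  have := wl_le S l.reverse (by simpa using h1)
  simpa using this

theorem wl_inv (hS : ∀ x ∈ S, x * x = 1)
  (hgen : Subgroup.closure S = ⊤) (w : W) :
    wordLength S w⁻¹ = wordLength S w :=
  le_antisymm (wl_inv_le hS hgen w) (by simpa using wl_inv_le hS hgen w⁻¹)

theorem wl_dec (hS : ∀ x ∈ S, x * x = 1)
  (hgen : Subgroup.closure S = ⊤) (w : W) (hw : w ≠ 1) :
    ∃ t ∈ S, ∃ v, w = t * v ∧ wordLength S v < wordLength S w := by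
  obtain ⟨l, h1, h2, h3⟩ := wl_exists S hS hgen w
  cases l with
  | nil => simp at h3; exact absurd h3.symm hw
  | cons t l =>
    refine ⟨t, h1 t (by simp), l.prod, by simpa using h3.symm, ?_⟩
    have := wl_le S l (fun x hx => h1 x (by simp [hx]))
    rw [← h2]
    simp
    omega

theorem wl_dec_right (hS : ∀ x ∈ S, x * x = 1)
  (hgen : Subgroup.closure S = ⊤) (w : W) (hw : w ≠ 1) :
    ∃ t ∈ S, ∃ v, w = v * t ∧ wordLength S v < wordLength S w := by
  obtain ⟨t, ht, v, h, hl⟩ := wl_dec hS hgen w⁻¹ (by simpa using hw)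
  refine ⟨t, ht, v⁻¹, ?_, ?_⟩
  · rw [← inv_inv w, h, mul_inv_rev, inv_eq_of_mul_eq_one_left (hS t ht)]
  · rwa [wl_inv hS hgen, ← wl_inv hS hgen w]

/-- The abstract properties of the family of double cosets. -/
structure DC {G : Type*} [Group G] {W : Type*} [Group W] (S : Set W) (D : W → Set G) : Prop where
  inv : ∀ w g, g ∈ D w → g⁻¹ ∈ D w⁻¹
  one : ∀ g, g ∈ D 1 → ∀ w h, h ∈ D w → g * h ∈ D w
  disj1 : ∀ w g, g ∈ D w → g ∈ D 1 → w = 1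
  split : ∀ v w g, g ∈ D (v * w) → ∃ a ∈ D v, ∃ b ∈ D w, g = a * b
  prod : ∀ t ∈ S, ∀ w g h, g ∈ D t → h ∈ D w → g * h ∈ D (t * w) ∨ g * h ∈ D w
  notB : ∀ t ∈ S, ∃ g ∈ D t, ∃ h ∈ D t, g * h ∈ D t
  ne : ∀ t ∈ S, t ≠ 1

variable {G : Type*} [Group G] {D : W → Set G}

theorem DC.prod_right (hS : ∀ x ∈ S, x * x = 1) (hD : DC S D) (t : W) (ht : t ∈ S) (w : W) (g h : G)
    (hg : g ∈ D w) (hh : h ∈ D t) : g * h ∈ D (w * t) ∨ g * h ∈ D w := by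
  have hti : t⁻¹ = t := inv_eq_of_mul_eq_one_left (hS t ht)
  have h1 := hD.inv _ _ hg
  have h2 := hD.inv _ _ hh
  rw [hti] at h2
  rcases hD.prod t ht _ _ _ h2 h1 with h | h
  · left
    have := hD.inv _ _ h
    simpa [hti] using this
  · right
    have := hD.inv _ _ h
    simpa [hti] using this

theorem DC.disj (hS : ∀ x ∈ S, x * x = 1) (hgen : Subgroup.closure S = ⊤) (hD : DC S D) :
    ∀ (n : ℕ) (w w' : W) (g : G), wordLength S w = n → wordLength S w ≤ wordLength S w' →
      g ∈ D w → g ∈ D w' → w = w' := by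
  intro n
  induction n using Nat.strong_induction_on with
  | _ n ih =>
    intro w w' g hn hle hg hg'
    by_cases hw : w = 1
    · subst hw
      exact (hD.disj1 _ _ hg' hg).symm
    obtain ⟨t, ht, v, rfl, hl⟩ := wl_dec hS hgen w hw
    obtain ⟨a, ha, b, hb, rfl⟩ := hD.split _ _ _ hg
    have hti : t⁻¹ = t := inv_eq_of_mul_eq_one_left (hS t ht)
    have ha' := hD.inv _ _ ha
    rw [hti] at ha'
    have h1 := hD.prod t ht _ _ _ ha' hg'
    rw [inv_mul_cancel_left] at h1
    rcases h1 with h1 | h1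
    · have h5 : wordLength S w' ≤ wordLength S (t * w') + 1 := by
        have := wl_mul hS hgen ht (t * w')
        rwa [← mul_assoc, hS t ht, one_mul] at this
      have := ih _ (by omega) v (t * w') b rfl (by omega) hb h1
      rw [this, ← mul_assoc, hS t ht, one_mul]
    · have := ih _ (by omega) v w' b rfl (by omega) hb h1
      subst this
      omega

theorem DC.disj' (hS : ∀ x ∈ S, x * x = 1) (hgen : Subgroup.closure S = ⊤) (hD : DC S D)
    (w w' : W) (g : G) (hg : g ∈ D w) (hg' : g ∈ D w') : w = w' := by
  rcases le_total (wordLength S w) (wordLength S w') with h | h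
  · exact DC.disj hS hgen hD _ w w' g rfl h hg hg'
  · exact (DC.disj hS hgen hD _ w' w g rfl h hg' hg).symm

theorem DC.prod_up (hS : ∀ x ∈ S, x * x = 1) (hgen : Subgroup.closure S = ⊤) (hD : DC S D)
    (t : W) (ht : t ∈ S) :
    ∀ (n : ℕ) (w : W) (g h : G), wordLength S w = n → wordLength S w ≤ wordLength S (t * w) →
      g ∈ D t → h ∈ D w → g * h ∈ D (t * w) := by
  intro n
  induction n using Nat.strong_induction_on with
  | _ n ih =>
    intro w g h hn hle hg hh
    rcases hD.prod t ht w g h hg hh with h1 | h1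
    · exact h1
    exfalso
    by_cases hw : w = 1
    · subst hw
      have h2 := hD.inv _ _ hh
      rw [inv_one] at h2
      have h3 := hD.one _ (by simpa using hD.inv _ _ h1) _ _ hg
      have h4 : g ∈ D 1 := by
        have h5 := hD.one _ h1 _ _ h2
        simpa using h5
      exact hD.ne t ht (hD.disj1 _ _ hg h4)
    obtain ⟨r, hr, v, rfl, hl⟩ := wl_dec_right hS hgen w hw
    obtain ⟨a, ha, b, hb, rfl⟩ := hD.split _ _ _ hh
    have hri : r⁻¹ = r := inv_eq_of_mul_eq_one_left (hS r hr)
    have hb' := hD.inv _ _ hb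
    rw [hri] at hb'
    have h5 : wordLength S (t * (v * r)) ≤ wordLength S (t * v) + 1 := by
      have := wl_mul hS hgen hr (t * v)⁻¹
      rw [wl_inv hS hgen] at this
      rw [← wl_inv hS hgen]
      simpa [hri, mul_assoc] using this
    have h6 := ih _ (by omega) v g a rfl (by omega) hg ha
    have h7 := hD.prod_right hS r hr _ _ _ h1 hb'
    rw [show g * (a * b) * b⁻¹ = g * a by group, mul_assoc, hS r hr, mul_one] at h7
    rcases h7 with h7 | h7
    · have := DC.disj' hS hgen hD _ _ _ h6 h7
      exact hD.ne t ht (by simpa using this)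
    · have := DC.disj' hS hgen hD _ _ _ h6 h7
      rw [← this, ← mul_assoc, hS t ht, one_mul] at hle
      rw [← this] at hl
      omega

theorem DC.long (hS : ∀ x ∈ S, x * x = 1) (hgen : Subgroup.closure S = ⊤) (hD : DC S D)
    (w₀ : W) (hw₀ : ∀ w, w ≠ w₀ → wordLength S w < wordLength S w₀) (t : W) (ht : t ∈ S)
    (y : G) (hy : y ∈ D w₀) : ∃ k ∈ D t, k * y ∈ D w₀ := by
  obtain ⟨g, hg, h, hh, hgh⟩ := hD.notB t ht
  rcases hD.prod t ht _ _ _ hh hy with h1 | h1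
  · refine ⟨g * h, hgh, ?_⟩
    have hlt := hw₀ (t * w₀) (by simpa using hD.ne t ht)
    have e : t * (t * w₀) = w₀ := by rw [← mul_assoc, hS t ht, one_mul]
    have := DC.prod_up hS hgen hD t ht _ (t * w₀) g (h * y) rfl (by rw [e]; exact hlt.le) hg h1
    rwa [e, ← mul_assoc] at this
  · exact ⟨h, hh, h1⟩

theorem DC.main (hS : ∀ x ∈ S, x * x = 1) (hgen : Subgroup.closure S = ⊤) (hD : DC S D)
    (w₀ : W) (hw₀ : ∀ w, w ≠ w₀ → wordLength S w < wordLength S w₀)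
    (x : G) (hx : x ∈ D w₀) (h1 : (1 : G) ∈ D 1) :
    ∀ (n : ℕ) (w : W), wordLength S w = n → ∃ g ∈ D w, g * x ∈ D w₀ := by
  intro n
  induction n using Nat.strong_induction_on with
  | _ n ih =>
    intro w hn
    by_cases hw : w = 1
    · subst hw
      exact ⟨1, h1, by simpa using hx⟩
    obtain ⟨t, ht, v, rfl, hl⟩ := wl_dec hS hgen w hw
    obtain ⟨g, hg, hgx⟩ := ih _ (by omega) v rfl
    obtain ⟨k, hk, hky⟩ := DC.long hS hgen hD w₀ hw₀ t ht _ hgx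
    exact ⟨k * g, DC.prod_up hS hgen hD t ht _ v k g rfl hl.le hk hg, by rwa [mul_assoc]⟩

end abs

/-- The double coset of `w`. -/
def dcos {G : Type*} [Group G] (B N : Subgroup G) [(B.subgroupOf N).Normal]
    (w : N ⧸ B.subgroupOf N) : Set G :=
  {g | ∃ b ∈ B, ∃ n : N, QuotientGroup.mk n = w ∧ ∃ c ∈ B, g = b * n * c}

theorem mk_eq_one {G : Type*} [Group G] {B N : Subgroup G} [(B.subgroupOf N).Normal] (n : N) :
    (QuotientGroup.mk n : N ⧸ B.subgroupOf N) = 1 ↔ (n : G) ∈ B := by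
  rw [QuotientGroup.eq_one_iff, Subgroup.mem_subgroupOf]

/-- change of representative -/
theorem dcos_rep {G : Type*} [Group G] {B N : Subgroup G} [(B.subgroupOf N).Normal]
    (n : N) (g : G) (hg : g ∈ dcos B N (QuotientGroup.mk n)) :
    ∃ b ∈ B, ∃ c ∈ B, g = b * n * c := by
  obtain ⟨b, hb, m, hm, c, hc, rfl⟩ := hg
  rw [eq_comm, QuotientGroup.eq, Subgroup.mem_subgroupOf] at hm
  exact ⟨b, hb, _, B.mul_mem hm hc, by push_cast; group⟩

theorem dcos_mem {G : Type*} [Group G] {B N : Subgroup G} [(B.subgroupOf N).Normal]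
    (n : N) {b c : G} (hb : b ∈ B) (hc : c ∈ B) :
    b * n * c ∈ dcos B N (QuotientGroup.mk n) := ⟨b, hb, n, rfl, c, hc, rfl⟩

theorem dcos_one {G : Type*} [Group G] {B N : Subgroup G} [(B.subgroupOf N).Normal] (g : G) :
    g ∈ dcos B N 1 ↔ g ∈ B := by
  constructor
  · intro h
    obtain ⟨b, hb, c, hc, rfl⟩ := dcos_rep (1 : N) g h
    simpa using B.mul_mem hb hc
  · intro h
    simpa using dcos_mem (B := B) (1 : N) h B.one_mem

theorem dcos_mul {G : Type*} [Group G] {B N : Subgroup G} [(B.subgroupOf N).Normal]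
    (w : N ⧸ B.subgroupOf N) {b c g : G} (hb : b ∈ B) (hc : c ∈ B) (hg : g ∈ dcos B N w) :
    b * g * c ∈ dcos B N w := by
  obtain ⟨b', hb', m, hm, c', hc', rfl⟩ := hg
  exact ⟨b * b', B.mul_mem hb hb', m, hm, c' * c, B.mul_mem hc' hc, by group⟩

theorem dcos_DC {G : Type*} [Group G] (B N : Subgroup G)
    [hH : (B.subgroupOf N).Normal]
    {I : Type*} (s : I → N ⧸ B.subgroupOf N)
    (axSq : ∀ i, s i * s i = 1)
    (axNotB : ∀ (i : I) (ni : N), QuotientGroup.mk ni = s i →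
      ({(ni : G)} : Set G) * (B : Set G) * {(ni : G)} ≠ (B : Set G))
    (axProd : ∀ (i : I) (ni n : N), QuotientGroup.mk ni = s i →
      ({(ni : G)} : Set G) * (B : Set G) * {(n : G)} ⊆
        (B : Set G) * {((ni * n : N) : G)} * (B : Set G) ∪
          (B : Set G) * {(n : G)} * (B : Set G)) : DC (Set.range s) (dcos B N) := by
  have prod : ∀ t ∈ Set.range s, ∀ w g h, g ∈ dcos B N t → h ∈ dcos B N w →
      g * h ∈ dcos B N (t * w) ∨ g * h ∈ dcos B N w := by
    rintro _ ⟨i, rfl⟩ w g h ⟨b, hb, n, hn, c, hc, rfl⟩ ⟨b', hb', m, rfl, c', hc', rfl⟩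
    have h1 : (n : G) * (c * b') * m ∈ ({(n : G)} : Set G) * (B : Set G) * {(m : G)} :=
      Set.mul_mem_mul (Set.mul_mem_mul rfl (B.mul_mem hc hb')) rfl
    have e : b * n * c * (b' * m * c') = b * (n * (c * b') * m) * c' := by group
    rw [e]
    rcases axProd i n m hn h1 with h2 | h2
    · left
      apply dcos_mul _ hb hc'
      obtain ⟨_, ⟨x, hx, _, rfl, rfl⟩, y, hy, h3⟩ := h2
      rw [← h3, ← hn, ← QuotientGroup.mk_mul]
      exact dcos_mem _ hx hy
    · right
      apply dcos_mul _ hb hc'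
      obtain ⟨_, ⟨x, hx, _, rfl, rfl⟩, y, hy, h3⟩ := h2
      rw [← h3]
      exact dcos_mem _ hx hy
  refine ⟨?_, ?_, ?_, ?_, prod, ?_, ?_⟩
  · rintro w g ⟨b, hb, n, rfl, c, hc, rfl⟩
    exact ⟨c⁻¹, B.inv_mem hc, n⁻¹, rfl, b⁻¹, B.inv_mem hb, by push_cast; group⟩
  · intro g hg w h hh
    rw [dcos_one] at hg
    simpa using dcos_mul w hg B.one_mem hh
  · rintro w g ⟨b, hb, n, rfl, c, hc, rfl⟩ h
    rw [dcos_one] at h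
    rw [mk_eq_one]
    have := B.mul_mem (B.mul_mem (B.inv_mem hb) h) (B.inv_mem hc)
    simpa [mul_assoc] using this
  · intro v w g hg
    obtain ⟨n, rfl⟩ := QuotientGroup.mk_surjective v
    obtain ⟨m, rfl⟩ := QuotientGroup.mk_surjective w
    rw [← QuotientGroup.mk_mul] at hg
    obtain ⟨b, hb, c, hc, rfl⟩ := dcos_rep _ _ hg
    exact ⟨b * n * 1, dcos_mem _ hb B.one_mem, 1 * m * c, dcos_mem _ B.one_mem hc,
      by push_cast; group⟩
  · rintro _ ⟨i, rfl⟩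
    obtain ⟨n, hn⟩ := QuotientGroup.mk_surjective (s i)
    have hnn : (n : G) * n ∈ B := by
      have := axSq i
      rw [← hn, ← QuotientGroup.mk_mul, mk_eq_one] at this
      simpa using this
    have hmem : (n : G) ∈ dcos B N (s i) := by
      rw [← hn]
      simpa using dcos_mem (B := B) n B.one_mem B.one_mem
    by_contra hcon
    push Not at hcon
    have key : ∀ b ∈ B, (n : G) * b * n ∈ B := by
      intro b hb
      have h1 : (n : G) * b ∈ dcos B N (s i) := by
        simpa using dcos_mul _ B.one_mem hb hmem
      rcases prod (s i) ⟨i, rfl⟩ _ _ _ h1 hmem with h | h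
      · rwa [axSq, dcos_one] at h
      · exact absurd h (hcon _ h1 _ hmem)
    apply axNotB i n hn
    apply Set.Subset.antisymm
    · rintro _ ⟨_, ⟨_, rfl, b, hb, rfl⟩, _, rfl, rfl⟩
      exact key b hb
    · intro b hb
      have h2 : (n : G)⁻¹ * b * (n : G)⁻¹ ∈ B := by
        have := B.mul_mem (B.mul_mem (B.inv_mem hnn) (key b hb)) (B.inv_mem hnn)
        convert this using 1
        group
      exact ⟨_, ⟨_, rfl, _, h2, rfl⟩, _, rfl, by group⟩
  · rintro _ ⟨i, rfl⟩ h
    have hn : (QuotientGroup.mk (1 : N) : N ⧸ B.subgroupOf N) = s i := by rw [h]; rfl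
    apply axNotB i 1 hn
    simp

/-- Let `G` be a group with a `BN`-pair whose Weyl group
`W = N / (B ∩ N)` is finite, let `n₀ ∈ N` be a preimage of the longest element `w₀`
of `W`, and let `U ≤ B` be a subgroup with `B = U H` where `H = B ∩ N`. Then
`G = H·U·U^{n₀}·U`. -/
theorem BN_pair_Gauss_decomposition {G : Type*} [Group G] (B N : Subgroup G)
    [hH : (B.subgroupOf N).Normal]
    {I : Type*} (s : I → N ⧸ B.subgroupOf N)
    -- (i) G is generated by B ∪ N
    (axBN : Subgroup.closure ((B : Set G) ∪ (N : Set G)) = ⊤)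
    -- (iii) the Weyl group is generated by the involutions `s i`
    (axGen : Subgroup.closure (Set.range s) = ⊤)
    (axSq : ∀ i, s i * s i = 1)
    -- (iv) `nᵢ B nᵢ ≠ B` for every preimage `nᵢ` of `s i`
    (axNotB : ∀ (i : I) (ni : N), QuotientGroup.mk ni = s i →
      ({(ni : G)} : Set G) * (B : Set G) * {(ni : G)} ≠ (B : Set G))
    -- (v) `nᵢ B n ⊆ B nᵢ n B ∪ B n B`
    (axProd : ∀ (i : I) (ni n : N), QuotientGroup.mk ni = s i →
      ({(ni : G)} : Set G) * (B : Set G) * {(n : G)} ⊆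
        (B : Set G) * {((ni * n : N) : G)} * (B : Set G) ∪
          (B : Set G) * {(n : G)} * (B : Set G))
    -- the Weyl group is finite, with longest element `w₀`
    [Finite (N ⧸ B.subgroupOf N)]
    (w₀ : N ⧸ B.subgroupOf N)
    (hw₀ : ∀ w : N ⧸ B.subgroupOf N, w ≠ w₀ →
      wordLength (Set.range s) w < wordLength (Set.range s) w₀)
    (n₀ : N) (hn₀ : QuotientGroup.mk n₀ = w₀)
    (U : Subgroup G) (hUB : U ≤ B)
    (hB : (U : Set G) * ((B ⊓ N : Subgroup G) : Set G) = (B : Set G)) :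
    ((B ⊓ N : Subgroup G) : Set G) * (U : Set G) * conjSet (U : Set G) (n₀ : G) *
        (U : Set G) = Set.univ := by
  have hD := dcos_DC B N s axSq axNotB axProd
  have hS : ∀ x ∈ Set.range s, x * x = 1 := by rintro _ ⟨i, rfl⟩; exact axSq i
  have h11 : (1 : G) ∈ dcos B N 1 := (dcos_one 1).2 B.one_mem
  -- multiplication of double cosets
  have hmul : ∀ (n : ℕ) (w w' : N ⧸ B.subgroupOf N) (g h : G),
      wordLength (Set.range s) w = n → g ∈ dcos B N w → h ∈ dcos B N w' →
      ∃ v, g * h ∈ dcos B N v := by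
    intro n
    induction n using Nat.strong_induction_on with
    | _ n ih =>
      intro w w' g h hn hg hh
      by_cases hw : w = 1
      · subst hw
        exact ⟨w', hD.one _ hg _ _ hh⟩
      obtain ⟨t, ht, v, rfl, hl⟩ := wl_dec hS axGen w hw
      obtain ⟨a, ha, b, hb, rfl⟩ := hD.split _ _ _ hg
      obtain ⟨u, hu⟩ := ih _ (by omega) v w' b h rfl hb hh
      rw [mul_assoc]
      rcases hD.prod t ht _ _ _ ha hu with h | h
      · exact ⟨_, h⟩
      · exact ⟨_, h⟩
  have bruhat : ∀ g : G, ∃ w, g ∈ dcos B N w := by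
    intro g
    have hg : g ∈ Subgroup.closure ((B : Set G) ∪ (N : Set G)) := by rw [axBN]; trivial
    induction hg using Subgroup.closure_induction with
    | mem x hx =>
      rcases hx with hx | hx
      · exact ⟨1, (dcos_one x).2 hx⟩
      · exact ⟨_, by simpa using dcos_mem (B := B) (⟨x, hx⟩ : N) B.one_mem B.one_mem⟩
    | one => exact ⟨1, h11⟩
    | mul x y _ _ hx hy =>
      obtain ⟨w, hw⟩ := hx
      obtain ⟨w', hw'⟩ := hy
      exact hmul _ w w' x y rfl hw hw'
    | inv x _ hx =>
      obtain ⟨w, hw⟩ := hx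
      exact ⟨_, hD.inv _ _ hw⟩
  have hinv : w₀⁻¹ = w₀ := by
    by_contra h
    have := hw₀ _ h
    rw [wl_inv hS axGen] at this
    exact lt_irrefl _ this
  have hn0i : QuotientGroup.mk n₀⁻¹ = w₀ := by
    rw [QuotientGroup.mk_inv, hn₀, hinv]
  have hx : (n₀ : G)⁻¹ ∈ dcos B N w₀ := by
    rw [← hn0i]
    simpa using dcos_mem (B := B) n₀⁻¹ B.one_mem B.one_mem
  have hUH : ∀ b ∈ B, ∃ u ∈ U, ∃ h ∈ B ⊓ N, b = u * h := by
    intro b hb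
    have : b ∈ (U : Set G) * ((B ⊓ N : Subgroup G) : Set G) := by rw [hB]; exact hb
    obtain ⟨u, hu, h, hh, rfl⟩ := this
    exact ⟨u, hu, h, hh, rfl⟩
  have hHU : ∀ b ∈ B, ∃ h ∈ B ⊓ N, ∃ u ∈ U, b = h * u := by
    intro b hb
    obtain ⟨u, hu, h, hh, e⟩ := hUH _ (B.inv_mem hb)
    exact ⟨h⁻¹, inv_mem hh, u⁻¹, inv_mem hu, by rw [← mul_inv_rev, ← e, inv_inv]⟩
  -- conjugation by `n₀` preserves `H`
  have hHn : ∀ h ∈ B ⊓ N, (n₀ : G) * h * (n₀ : G)⁻¹ ∈ B ⊓ N := by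
    rintro h ⟨h1, h2⟩
    have := hH.conj_mem (⟨h, h2⟩ : N) (by rw [Subgroup.mem_subgroupOf]; exact h1) n₀
    rw [Subgroup.mem_subgroupOf] at this
    exact ⟨by simpa using this, N.mul_mem (N.mul_mem n₀.2 h2) (N.inv_mem n₀.2)⟩
  have hHn' : ∀ h ∈ B ⊓ N, (n₀ : G)⁻¹ * h * (n₀ : G) ∈ B ⊓ N := by
    rintro h ⟨h1, h2⟩
    have := hH.conj_mem (⟨h, h2⟩ : N) (by rw [Subgroup.mem_subgroupOf]; exact h1) n₀⁻¹
    rw [Subgroup.mem_subgroupOf] at this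
    exact ⟨by simpa using this, N.mul_mem (N.mul_mem (N.inv_mem n₀.2) h2) n₀.2⟩
  apply Set.eq_univ_of_forall
  intro g
  obtain ⟨w, hg⟩ := bruhat g
  obtain ⟨k, hk, hkx⟩ := DC.main hS axGen hD w₀ hw₀ _ hx h11 _ w rfl
  obtain ⟨b, hb, c, hc, e1⟩ := dcos_rep n₀⁻¹ _ (by rw [hn0i]; exact hkx)
  obtain ⟨n, rfl⟩ := QuotientGroup.mk_surjective w
  obtain ⟨p, hp, q, hq, e2⟩ := dcos_rep n _ hg
  obtain ⟨p', hp', q', hq', e3⟩ := dcos_rep n _ hk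
  obtain ⟨h1, hh1, u3, hu3, e4⟩ := hHU (q'⁻¹ * q) (B.mul_mem (B.inv_mem hq') hq)
  obtain ⟨h2, hh2, u2, hu2, e5⟩ :=
    hHU (c * ((n₀ : G) * h1 * (n₀ : G)⁻¹)) (B.mul_mem hc (hHn h1 hh1).1)
  obtain ⟨h3, hh3, u1, hu1, e6⟩ :=
    hHU (p * p'⁻¹ * b * ((n₀ : G)⁻¹ * h2 * (n₀ : G)))
      (B.mul_mem (B.mul_mem (B.mul_mem hp (B.inv_mem hp')) hb) (hHn' h2 hh2).1)
  refine ⟨h3 * u1 * ((n₀ : G)⁻¹ * u2 * n₀), ⟨h3 * u1, ⟨h3, hh3, u1, hu1, rfl⟩, _,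
    ⟨u2, hu2, rfl⟩, rfl⟩, u3, hu3, ?_⟩
  have e7 : k = b * (n₀ : G)⁻¹ * c * n₀ := by
    rw [eq_comm, ← eq_mul_inv_iff_mul_eq, eq_comm]
    simpa using e1
  have e8 : u2 = h2⁻¹ * (c * ((n₀ : G) * h1 * (n₀ : G)⁻¹)) := by rw [e5]; group
  have e9 : u3 = h1⁻¹ * (q'⁻¹ * q) := by rw [e4]; group
  have e10 : (n : G) = p'⁻¹ * (b * (n₀ : G)⁻¹ * c * n₀) * q'⁻¹ := by rw [← e7, e3]; group
  change h3 * u1 * ((n₀ : G)⁻¹ * u2 * n₀) * u3 = g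
  rw [← e6, e8, e9, e2, e10]
  group
end

section
/- Let G be a group with a BN-pair whose Weyl group W is finite, let I' ⊆ I, let W_{I'} = ⟨s_i : i ∈ I'⟩ be the corresponding standard parabolic subgroup of W, and let N' be the full preimage of W_{I'} in N. If W is the setwise product of three conjugates of W_{I'}, i.e., there exist a, b, c ∈ W with W = (a⁻¹W_{I'}a)(b⁻¹W_{I'}b)(c⁻¹W_{I'}c), then G is the setwise product of three conjugates of the standard parabolic subgroup P = B N' B, i.e., there exist g, h, k ∈ G with G = (g⁻¹Pg)(h⁻¹Ph)(k⁻¹Pk). -/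
open Pointwise

/-- Bruhat decomposition `G = B N B`. -/
theorem bruhat_decomp {G : Type*} [Group G] (B N : Subgroup G)
    [hH : (B.subgroupOf N).Normal]
    {I : Type*} (s : I → N ⧸ B.subgroupOf N)
    (axBN : Subgroup.closure ((B : Set G) ∪ (N : Set G)) = ⊤)
    (axGen : Subgroup.closure (Set.range s) = ⊤)
    (axSq : ∀ i, s i * s i = 1)
    (axProd : ∀ (i : I) (ni n : N), QuotientGroup.mk ni = s i →
      ({(ni : G)} : Set G) * (B : Set G) * {(n : G)} ⊆
        (B : Set G) * {((ni * n : N) : G)} * (B : Set G) ∪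
          (B : Set G) * {(n : G)} * (B : Set G)) (g : G) :
    ∃ b1 ∈ B, ∃ n : N, ∃ b2 ∈ B, g = b1 * n * b2 := by
  let S : G → Prop := fun g => ∃ b1 ∈ B, ∃ n : N, ∃ b2 ∈ B, g = b1 * n * b2
  have hB : ∀ b ∈ B, ∀ x, S x → S (b * x) := by
    rintro b hb x ⟨b1, h1, n, b2, h2, rfl⟩
    exact ⟨b * b1, B.mul_mem hb h1, n, b2, h2, by group⟩
  have hs : ∀ i, ∀ ni : N, QuotientGroup.mk ni = s i → ∀ x, S x → S ((ni : G) * x) := by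
    rintro i ni hi x ⟨b1, h1, n, b2, h2, rfl⟩
    have := axProd i ni n hi (Set.mul_mem_mul (Set.mul_mem_mul rfl h1) rfl)
    rcases this with ⟨_, ⟨c1, hc1, _, rfl, rfl⟩, c2, hc2, h⟩ |
      ⟨_, ⟨c1, hc1, _, rfl, rfl⟩, c2, hc2, h⟩
    · refine ⟨c1, hc1, ni * n, c2 * b2, B.mul_mem hc2 h2, ?_⟩
      rw [← mul_assoc, ← mul_assoc]
      dsimp only at h
      rw [← h]; group
    · refine ⟨c1, hc1, n, c2 * b2, B.mul_mem hc2 h2, ?_⟩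
      rw [← mul_assoc, ← mul_assoc]
      dsimp only at h
      rw [← h]; group
  have hN : ∀ w : N ⧸ B.subgroupOf N, ∀ n : N, QuotientGroup.mk n = w →
      ∀ x, S x ↔ S ((n : G) * x) := by
    intro w
    have hw : w ∈ Subgroup.closure (Set.range s) := by rw [axGen]; trivial
    induction hw using Subgroup.closure_induction with
    | mem w hw =>
      obtain ⟨i, rfl⟩ := hw
      intro n hn x
      refine ⟨hs i n hn x, fun h => ?_⟩
      have := hs i n⁻¹ (by rw [QuotientGroup.mk_inv, hn, inv_eq_iff_mul_eq_one, axSq]) _ h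
      simpa using this
    | one =>
      intro n hn x
      have hn' : (n : G) ∈ B := by
        rw [QuotientGroup.eq_one_iff] at hn
        exact hn
      refine ⟨hB _ hn' x, fun h => ?_⟩
      simpa using hB _ (B.inv_mem hn') _ h
    | mul u v _ _ hu hv =>
      intro n hn x
      obtain ⟨m, rfl⟩ := QuotientGroup.mk_surjective u
      have h1 := hv (m⁻¹ * n) (by rw [QuotientGroup.mk_mul, hn, QuotientGroup.mk_inv]; group) x
      rw [h1, hu m rfl]
      simp [mul_assoc]
    | inv u _ hu =>
      intro n hn x
      have := hu n⁻¹ (by rw [QuotientGroup.mk_inv, hn, inv_inv]) ((n : G) * x)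
      rw [this]; simp
  have hG : ∀ x, S x ↔ S (g * x) := by
    have hg : g ∈ Subgroup.closure ((B : Set G) ∪ (N : Set G)) := by rw [axBN]; trivial
    induction hg using Subgroup.closure_induction with
    | mem g hg =>
      intro x
      rcases hg with hg | hg
      · exact ⟨hB _ hg x, fun h => by simpa using hB _ (B.inv_mem hg) _ h⟩
      · exact hN _ ⟨g, hg⟩ rfl x
    | one => simp
    | mul u v _ _ hu hv =>
      intro x
      rw [hv, hu, mul_assoc]
    | inv u _ hu =>
      intro x
      rw [hu (u⁻¹ * x)]; simp
  have h1 : S 1 := ⟨1, B.one_mem, 1, 1, B.one_mem, by simp⟩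
  have h2 := (hG 1).1 h1
  rw [mul_one] at h2
  exact h2

/-- Let `G` be a group with a `BN`-pair whose Weyl group `W` is
finite, let `I' ⊆ I`, let `W_{I'} = ⟨sᵢ : i ∈ I'⟩` and let `P = B N' B` where `N'`
is the preimage of `W_{I'}` in `N`. If `W` is the setwise product of three conjugates
of `W_{I'}`, then `G` is the setwise product of three conjugates of `P`. -/
theorem BN_pair_parabolic_three_conjugates {G : Type*} [Group G] (B N : Subgroup G)
    [hH : (B.subgroupOf N).Normal]
    {I : Type*} (s : I → N ⧸ B.subgroupOf N)
    -- (i) G is generated by B ∪ N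
    (axBN : Subgroup.closure ((B : Set G) ∪ (N : Set G)) = ⊤)
    -- (iii) the Weyl group is generated by the involutions `s i`
    (axGen : Subgroup.closure (Set.range s) = ⊤)
    (axSq : ∀ i, s i * s i = 1)
    -- (iv) `nᵢ B nᵢ ≠ B` for every preimage `nᵢ` of `s i`
    (axNotB : ∀ (i : I) (ni : N), QuotientGroup.mk ni = s i →
      ({(ni : G)} : Set G) * (B : Set G) * {(ni : G)} ≠ (B : Set G))
    -- (v) `nᵢ B n ⊆ B nᵢ n B ∪ B n B`
    (axProd : ∀ (i : I) (ni n : N), QuotientGroup.mk ni = s i →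
      ({(ni : G)} : Set G) * (B : Set G) * {(n : G)} ⊆
        (B : Set G) * {((ni * n : N) : G)} * (B : Set G) ∪
          (B : Set G) * {(n : G)} * (B : Set G))
    -- the Weyl group is finite
    [Finite (N ⧸ B.subgroupOf N)]
    (I' : Set I)
    -- `W` is the setwise product of three conjugates of `W_{I'} = ⟨sᵢ : i ∈ I'⟩`
    (hW : ∃ a b c : N ⧸ B.subgroupOf N,
      conjSet ((Subgroup.closure (s '' I') : Subgroup (N ⧸ B.subgroupOf N)) :
          Set (N ⧸ B.subgroupOf N)) a *
        conjSet ((Subgroup.closure (s '' I') : Subgroup (N ⧸ B.subgroupOf N)) :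
          Set (N ⧸ B.subgroupOf N)) b *
        conjSet ((Subgroup.closure (s '' I') : Subgroup (N ⧸ B.subgroupOf N)) :
          Set (N ⧸ B.subgroupOf N)) c = Set.univ) :
    -- then `G` is the setwise product of three conjugates of `P = B N' B`
    ∃ g h k : G,
      conjSet ((B : Set G) *
          (((Subgroup.closure (s '' I')).comap
              (QuotientGroup.mk' (B.subgroupOf N))).map N.subtype : Set G) *
          (B : Set G)) g *
        conjSet ((B : Set G) *
          (((Subgroup.closure (s '' I')).comap
              (QuotientGroup.mk' (B.subgroupOf N))).map N.subtype : Set G) *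
          (B : Set G)) h *
        conjSet ((B : Set G) *
          (((Subgroup.closure (s '' I')).comap
              (QuotientGroup.mk' (B.subgroupOf N))).map N.subtype : Set G) *
          (B : Set G)) k = Set.univ := by
  classical
  obtain ⟨a, b, c, habc⟩ := hW
  obtain ⟨na, rfl⟩ := QuotientGroup.mk_surjective a
  obtain ⟨nb, rfl⟩ := QuotientGroup.mk_surjective b
  obtain ⟨nc, rfl⟩ := QuotientGroup.mk_surjective c
  have key : ∀ n : N, (QuotientGroup.mk n : N ⧸ B.subgroupOf N) ∈ Subgroup.closure (s '' I') →
      ∀ b1 ∈ B, ∀ b2 ∈ B, b1 * (n : G) * b2 ∈ ((B : Set G) *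
          (((Subgroup.closure (s '' I')).comap
              (QuotientGroup.mk' (B.subgroupOf N))).map N.subtype : Set G) *
          (B : Set G)) := by
    intro n hn b1 hb1 b2 hb2
    refine Set.mul_mem_mul (Set.mul_mem_mul (hb1) ?_) hb2
    exact ⟨n, hn, rfl⟩
  refine ⟨na, nb, nc, Set.eq_univ_of_forall fun g => ?_⟩
  obtain ⟨b1, hb1, n, b2, hb2, hg⟩ := bruhat_decomp B N s axBN axGen axSq axProd
    ((na : G) * g * (nc : G)⁻¹)
  have hmem : (QuotientGroup.mk (na⁻¹ * n * nc) : N ⧸ B.subgroupOf N) ∈ (Set.univ : Set _) :=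
    Set.mem_univ _
  rw [← habc] at hmem
  obtain ⟨_, ⟨_, ⟨w1, hw1, rfl⟩, _, ⟨w2, hw2, rfl⟩, rfl⟩, _, ⟨w3, hw3, rfl⟩, h⟩ := hmem
  obtain ⟨m1, rfl⟩ := QuotientGroup.mk_surjective w1
  obtain ⟨m2, rfl⟩ := QuotientGroup.mk_surjective w2
  obtain ⟨m3, hm3⟩ : ∃ m3 : N, m3 = (m1 * na * nb⁻¹ * m2 * nb * nc⁻¹)⁻¹ * n := ⟨_, rfl⟩
  have h3 : (QuotientGroup.mk m3 : N ⧸ B.subgroupOf N) = w3 := by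
    rw [hm3]
    simp only [QuotientGroup.mk_mul, QuotientGroup.mk_inv] at h ⊢
    generalize (QuotientGroup.mk na : N ⧸ B.subgroupOf N) = a at *
    generalize (QuotientGroup.mk nb : N ⧸ B.subgroupOf N) = b at *
    generalize (QuotientGroup.mk nc : N ⧸ B.subgroupOf N) = c at *
    generalize (QuotientGroup.mk n : N ⧸ B.subgroupOf N) = w at *
    have h' : w = a * (a⁻¹ * w * c) * c⁻¹ := by group
    rw [h', ← h]
    group
  rw [← h3] at hw3
  have hn : (n : G) = m1 * na * (nb : G)⁻¹ * m2 * nb * (nc : G)⁻¹ * m3 := by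
    rw [hm3]; push_cast; group
  have hg' : g = (na : G)⁻¹ * (b1 * n * b2) * nc := by rw [← hg]; group
  refine ⟨_, ⟨_, ⟨_, key m1 hw1 b1 hb1 1 B.one_mem, rfl⟩, _,
    ⟨_, key m2 hw2 1 B.one_mem 1 B.one_mem, rfl⟩, rfl⟩, _,
    ⟨_, key m3 hw3 1 B.one_mem b2 hb2, rfl⟩, ?_⟩
  rw [hg', hn]
  group
end

section
/- Let n ≥ 3, let G be the symmetric group on n letters, and let A be the stabilizer of a point in the natural action of G. Then for every involution x ∈ G with x ∉ A one has G = (AxA)(AxA); in particular, the symmetric group on n ≥ 3 letters is the setwise product of three conjugates of the stabilizer of a point. -/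
open Pointwise

lemma mem_dcoset_of_moves {n : ℕ} (p : Fin n) (x g : Equiv.Perm (Fin n))
    (hx : x p ≠ p) (hg : g p ≠ p) :
    ∃ a b : Equiv.Perm (Fin n), a p = p ∧ b p = p ∧ g = a * x * b := by
  refine ⟨Equiv.swap (x p) (g p), (Equiv.swap (x p) (g p) * x)⁻¹ * g, ?_, ?_, ?_⟩
  · exact Equiv.swap_apply_of_ne_of_ne hx.symm hg.symm
  · rw [Equiv.Perm.mul_apply, Equiv.Perm.inv_eq_iff_eq]
    simp
  · group

lemma exists_factor {n : ℕ} (hn : 3 ≤ n) (p : Fin n) (x g : Equiv.Perm (Fin n))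
    (hx : x p ≠ p) :
    ∃ a b c d : Equiv.Perm (Fin n), a p = p ∧ b p = p ∧ c p = p ∧ d p = p ∧
      g = (a * x * b) * (c * x * d) := by
  obtain ⟨q, hq⟩ : ∃ q : Fin n, q ∉ ({p, g⁻¹ p} : Finset (Fin n)) := by
    by_contra! h
    have h1 : (Finset.univ : Finset (Fin n)) ⊆ {p, g⁻¹ p} := fun q _ => h q
    have h2 := Finset.card_le_card h1
    have h3 := Finset.card_le_two (a := p) (b := g⁻¹ p)
    simp only [Finset.card_univ, Fintype.card_fin] at h2
    omega
  simp only [Finset.mem_insert, Finset.mem_singleton, not_or] at hq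
  obtain ⟨a, b, ha, hb, hu⟩ := mem_dcoset_of_moves p x (g * Equiv.swap p q) hx (by
    rw [Equiv.Perm.mul_apply, Equiv.swap_apply_left]
    intro h
    exact hq.2 (by rw [← h]; simp))
  obtain ⟨c, d, hc, hd, hv⟩ := mem_dcoset_of_moves p x (Equiv.swap p q) hx (by
    rw [Equiv.swap_apply_left]; exact hq.1)
  refine ⟨a, b, c, d, ha, hb, hc, hd, ?_⟩
  rw [← hu, ← hv, mul_assoc, Equiv.swap_mul_self, mul_one]

/-- Let `n ≥ 3`, `G = Sym(n)` and `A` the stabilizer of a point.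
Then for every involution `x ∉ A` one has `G = (AxA)(AxA)`; in particular `G` is
the setwise product of three conjugates of `A`. -/
theorem symmetricGroup_point_stabilizer_dcoset_sq (n : ℕ) (hn : 3 ≤ n) (p : Fin n) :
    (∀ x : Equiv.Perm (Fin n), orderOf x = 2 →
      x ∉ MulAction.stabilizer (Equiv.Perm (Fin n)) p →
      dcoset ((MulAction.stabilizer (Equiv.Perm (Fin n)) p : Subgroup (Equiv.Perm (Fin n))) :
          Set (Equiv.Perm (Fin n))) x *
        dcoset ((MulAction.stabilizer (Equiv.Perm (Fin n)) p : Subgroup (Equiv.Perm (Fin n))) :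
          Set (Equiv.Perm (Fin n))) x = Set.univ) ∧
    (∃ g₁ g₂ g₃ : Equiv.Perm (Fin n),
      conjSet ((MulAction.stabilizer (Equiv.Perm (Fin n)) p : Subgroup (Equiv.Perm (Fin n))) :
          Set (Equiv.Perm (Fin n))) g₁ *
        conjSet ((MulAction.stabilizer (Equiv.Perm (Fin n)) p : Subgroup (Equiv.Perm (Fin n))) :
          Set (Equiv.Perm (Fin n))) g₂ *
        conjSet ((MulAction.stabilizer (Equiv.Perm (Fin n)) p : Subgroup (Equiv.Perm (Fin n))) :
          Set (Equiv.Perm (Fin n))) g₃ = Set.univ) := by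
  refine ⟨?_, ?_⟩
  · intro x _ hx
    rw [Set.eq_univ_iff_forall]
    intro g
    obtain ⟨a, b, c, d, ha, hb, hc, hd, h⟩ := exists_factor hn p x g hx
    rw [h]
    exact Set.mul_mem_mul (Set.mul_mem_mul (Set.mul_mem_mul ha rfl) hb)
      (Set.mul_mem_mul (Set.mul_mem_mul hc rfl) hd)
  · haveI : Nontrivial (Fin n) := Fin.nontrivial_iff_two_le.mpr (by omega)
    obtain ⟨q, hq⟩ := exists_ne p
    refine ⟨1, Equiv.swap p q, 1, ?_⟩
    rw [Set.eq_univ_iff_forall]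
    intro g
    obtain ⟨a, b, c, d, ha, hb, hc, hd, h⟩ := exists_factor hn p (Equiv.swap p q) g
      (by rw [Equiv.swap_apply_left]; exact hq)
    have hbc : (b * c) p = p := by rw [Equiv.Perm.mul_apply, hc, hb]
    refine Set.mem_mul.mpr ⟨_, Set.mul_mem_mul ⟨a, ha, rfl⟩ ⟨b * c, hbc, rfl⟩, _, ⟨d, hd, rfl⟩, ?_⟩
    rw [h]
    simp [mul_assoc]
end
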